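/- Propagation of regularity for the von Neumann equation in Weyl variables (Proposition 4.1): let m ≥ 1 and let V : ℝ → ℝ be of class C^{m+1} with ‖V⁽ⁿ⁾‖_∞ < ∞ for n = 2,…,m+1. Then there exists a constant C > 0 depending only on m and V (in particular, independent of ħ) such that for every ħ ∈ (0,1] and every strong solution R of the von Neumann equation in Weyl variables with parameter ħ, one has 𝒩_m(t) ≤ 𝒩_m(0) e^{C t} for all t ≥ 0. -/

import Mathlib

open MeasureTheory

noncomputable section

/-- Mixed partial derivative `∂_x^b ∂_y^β` of a function `f(x,y)`. -/
def pd2 (b β : ℕ) (f : ℝ → ℝ → ℂ) (x y : ℝ) : ℂ :=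
  iteratedDeriv b (fun x' => iteratedDeriv β (fun y' => f x' y') y) x

/-- Weighted derivative `x^a ∂_x^b y^α ∂_y^β` of `f(x,y)`. -/
def wD (a b α β : ℕ) (f : ℝ → ℝ → ℂ) (x y : ℝ) : ℂ :=
  (x : ℂ) ^ a * (y : ℂ) ^ α * pd2 b β f x y

/-- Uncurried version of a two-variable function. -/
def unc (f : ℝ → ℝ → ℂ) : ℝ × ℝ → ℂ := fun p => f p.1 p.2

/-- L² norm over ℝ². -/
def L2 (f : ℝ → ℝ → ℂ) : ℝ := (eLpNorm (unc f) 2 (volume : Measure (ℝ × ℝ))).toReal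

/-- L² norm over ℝ. -/
def L2one (f : ℝ → ℂ) : ℝ := (eLpNorm f 2 (volume : Measure ℝ)).toReal

/-- Schwartz-class predicate for smooth functions of two real variables. -/
def IsSchwartz2 (f : ℝ → ℝ → ℂ) : Prop :=
  ContDiff ℝ (⊤ : ℕ∞) (unc f) ∧
    ∀ k n : ℕ, ∃ C : ℝ, ∀ p : ℝ × ℝ, ‖p‖ ^ k * ‖iteratedFDeriv ℝ n (unc f) p‖ ≤ C

/-- Schwartz-class predicate for smooth functions of one real variable. -/
def IsSchwartz1 (f : ℝ → ℂ) : Prop :=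
  ContDiff ℝ (⊤ : ℕ∞) f ∧ ∀ k n : ℕ, ∃ C : ℝ, ∀ x : ℝ, |x| ^ k * ‖iteratedDeriv n f x‖ ≤ C

/-- Time derivative of a time-dependent two-variable function. -/
def dtR (R : ℝ → ℝ → ℝ → ℂ) (t x y : ℝ) : ℂ := deriv (fun s => R s x y) t

/-- For all `a b α β`, the map `t ↦ x^a ∂_x^b y^α ∂_y^β R(t,·,·)` is continuously
differentiable from `[0,∞)` into `L²(ℝ²)` with derivative `x^a ∂_x^b y^α ∂_y^β ∂_t R(t,·,·)`. -/
def C1intoL2 (R : ℝ → ℝ → ℝ → ℂ) : Prop :=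
  ∀ a b α β : ℕ, ∃ Ψ Ψ' : ℝ → Lp ℂ 2 (volume : Measure (ℝ × ℝ)),
    (∀ t : ℝ, 0 ≤ t → (Ψ t : ℝ × ℝ → ℂ) =ᵐ[volume] unc (wD a b α β (R t))) ∧
    (∀ t : ℝ, 0 ≤ t → (Ψ' t : ℝ × ℝ → ℂ) =ᵐ[volume] unc (wD a b α β (dtR R t))) ∧
    (∀ t : ℝ, 0 ≤ t → HasDerivWithinAt Ψ (Ψ' t) (Set.Ici 0) t) ∧
    ContinuousOn Ψ' (Set.Ici 0)

/-- Regularity part of the notion of strong solution on `[0,∞) × ℝ²`. -/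
def IsRegularSol (R : ℝ → ℝ → ℝ → ℂ) : Prop :=
  ContDiffOn ℝ (⊤ : ℕ∞) (fun p : ℝ × ℝ × ℝ => R p.1 p.2.1 p.2.2) {p : ℝ × ℝ × ℝ | 0 ≤ p.1} ∧
  (∀ t : ℝ, 0 ≤ t → IsSchwartz2 (R t)) ∧ C1intoL2 R

/-- Strong solution of the von Neumann equation in Weyl variables. -/
def IsVNSol (hbar : ℝ) (V : ℝ → ℝ) (R : ℝ → ℝ → ℝ → ℂ) : Prop :=
  IsRegularSol R ∧
  ∀ t : ℝ, 0 ≤ t → ∀ x y : ℝ,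
    dtR R t x y = Complex.I * pd2 1 1 (R t) x y -
      Complex.I * (((V (x + hbar * y / 2) - V (x - hbar * y / 2)) / hbar : ℝ) : ℂ) * R t x y

/-- Strong solution of the semiclassical equation. -/
def IsSCSol (V : ℝ → ℝ) (R : ℝ → ℝ → ℝ → ℂ) : Prop :=
  IsRegularSol R ∧
  ∀ t : ℝ, 0 ≤ t → ∀ x y : ℝ,
    dtR R t x y = Complex.I * pd2 1 1 (R t) x y -
      Complex.I * ((deriv V x * y : ℝ) : ℂ) * R t x y

/-- The weighted Sobolev functional `𝒩_m` applied to a function of `(x,y)`. -/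
def NN (m : ℕ) (f : ℝ → ℝ → ℂ) : ℝ :=
  ∑ q ∈ Finset.filter
      (fun q : ℕ × ℕ × ℕ × ℕ => q.1 + q.2.1 + q.2.2.1 + q.2.2.2 ≤ m)
      (Finset.range (m+1) ×ˢ Finset.range (m+1) ×ˢ Finset.range (m+1) ×ˢ Finset.range (m+1)),
    L2 (wD q.1 q.2.1 q.2.2.1 q.2.2.2 f)

/-- Supremum norm of a real-valued function. -/
def supN (f : ℝ → ℝ) : ℝ := ⨆ x : ℝ, |f x|

/-- The constant `C_m[V]`. -/
def CmV (m : ℕ) (V : ℝ → ℝ) : ℝ :=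
  ((m : ℝ)^2 + 2*m + m * supN (iteratedDeriv 2 V) + m * |deriv V 0|) +
    2^m * (1+m) * m * (⨆ n ∈ Finset.Icc 2 (m+1), supN (iteratedDeriv n V))

/-- Physicists' Hermite polynomial. -/
def Hpoly (k : ℕ) (y : ℝ) : ℝ :=
  (-1)^k * Real.exp (y^2) * iteratedDeriv k (fun z => Real.exp (-z^2)) y

/-- Hermite function `Φ_k`. -/
def Φh (k : ℕ) (y : ℝ) : ℝ :=
  ((2:ℝ)^k * (Nat.factorial k : ℝ) * Real.sqrt Real.pi) ^ (-(1:ℝ)/2) *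
    Real.exp (-y^2/2) * Hpoly k y

/-- The operator `𝒟 u = ∂_x u + V'(x) u`. -/
def Dop (V : ℝ → ℝ) (u : ℝ → ℂ) (x : ℝ) : ℂ := deriv u x + ((deriv V x : ℝ) : ℂ) * u x

/-- The operator `𝒟* u = −∂_x u + V'(x) u`. -/
def Dstar (V : ℝ → ℝ) (u : ℝ → ℂ) (x : ℝ) : ℂ := -deriv u x + ((deriv V x : ℝ) : ℂ) * u x

/-- The quantum correction `ℰ^ħ(x,y)`. -/
def Eh (hbar : ℝ) (V : ℝ → ℝ) (x y : ℝ) : ℝ :=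
  (V (x + hbar * y / 2) - V (x - hbar * y / 2)) / hbar - deriv V x * y

/-- Matrix elements `ℰ^ħ_{k,l}(x)` of the quantum correction. -/
def Ekl (hbar : ℝ) (V : ℝ → ℝ) (k l : ℕ) (x : ℝ) : ℝ :=
  ∫ y : ℝ, Eh hbar V x y * Φh k y * Φh l y

/-- `t ↦ u(t,·)` is continuously differentiable from `[0,∞)` into `L²(ℝ)` with
derivative `∂_t u`. -/
def C1intoL2one (u : ℝ → ℝ → ℂ) : Prop :=
  ∃ Ψ Ψ' : ℝ → Lp ℂ 2 (volume : Measure ℝ),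
    (∀ t : ℝ, 0 ≤ t → (Ψ t : ℝ → ℂ) =ᵐ[volume] u t) ∧
    (∀ t : ℝ, 0 ≤ t → (Ψ' t : ℝ → ℂ) =ᵐ[volume] fun x => deriv (fun s => u s x) t) ∧
    (∀ t : ℝ, 0 ≤ t → HasDerivWithinAt Ψ (Ψ' t) (Set.Ici 0) t) ∧
    ContinuousOn Ψ' (Set.Ici 0)

/-- Regularity part of the notion of strong solution of a Hermite–Galerkin system of size `N`;
the convention `R_k = 0` for `k > N` is included. -/
def IsGalerkinReg (N : ℕ) (R : ℕ → ℝ → ℝ → ℂ) : Prop :=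
  (∀ k, k ≤ N → ContDiffOn ℝ (⊤ : ℕ∞) (fun p : ℝ × ℝ => R k p.1 p.2) {p : ℝ × ℝ | 0 ≤ p.1}) ∧
  (∀ k, k ≤ N → ∀ t : ℝ, 0 ≤ t → IsSchwartz1 (R k t)) ∧
  (∀ k, k ≤ N → C1intoL2one (R k)) ∧
  (∀ k, N < k → ∀ t x : ℝ, R k t x = 0)

/-- Strong solution of the semiclassical Hermite–Galerkin system of size `N`.
(For `k = 0` the coefficient `√(k/2)` vanishes, so the term `R_{k-1}` is harmless.) -/
def IsSCGalerkinSol (V : ℝ → ℝ) (N : ℕ) (R : ℕ → ℝ → ℝ → ℂ) : Prop :=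
  IsGalerkinReg N R ∧
  ∀ k, k ≤ N → ∀ t : ℝ, 0 ≤ t → ∀ x : ℝ,
    deriv (fun s => R k s x) t +
      Complex.I * ((Real.sqrt ((k : ℝ)/2) : ℂ) * Dop V (R (k-1) t) x +
        (Real.sqrt (((k : ℝ)+1)/2) : ℂ) * Dstar V (R (k+1) t) x) = 0

/-- Strong solution of the von Neumann Hermite–Galerkin system of size `N`. -/
def IsVNGalerkinSol (hbar : ℝ) (V : ℝ → ℝ) (N : ℕ) (R : ℕ → ℝ → ℝ → ℂ) : Prop :=
  IsGalerkinReg N R ∧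
  ∀ k, k ≤ N → ∀ t : ℝ, 0 ≤ t → ∀ x : ℝ,
    deriv (fun s => R k s x) t +
      Complex.I * ((Real.sqrt ((k : ℝ)/2) : ℂ) * Dop V (R (k-1) t) x +
        (Real.sqrt (((k : ℝ)+1)/2) : ℂ) * Dstar V (R (k+1) t) x) =
      -Complex.I * ∑ l ∈ Finset.range (N+1), ((Ekl hbar V k l x : ℝ) : ℂ) * R l t x

/-- Smooth potential with all derivatives of order `≥ 2` bounded. -/
def SmoothBounded (V : ℝ → ℝ) : Prop :=
  ContDiff ℝ (⊤ : ℕ∞) V ∧ ∀ n : ℕ, 2 ≤ n → ∃ C : ℝ, ∀ x : ℝ, |iteratedDeriv n V x| ≤ C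

/-- The harmonic-oscillator operator `A G = y² G − G''`. -/
def Aop (g : ℝ → ℂ) : ℝ → ℂ := fun y => (y : ℂ)^2 * g y - iteratedDeriv 2 g y

/-- Grönwall estimate for the sum of the norms of a finite family of curves in a real inner
product space whose energies are controlled by the full sum. -/
lemma sum_norm_le_of_inner_deriv_le {ι H : Type*} [NormedAddCommGroup H] [InnerProductSpace ℝ H]
    (s : Finset ι) (Ψ Ψ' : ι → ℝ → H) {K : ℝ} (hK : 0 ≤ K)
    (hd : ∀ q ∈ s, ∀ t : ℝ, 0 ≤ t → HasDerivWithinAt (Ψ q) (Ψ' q t) (Set.Ici 0) t)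
    (he : ∀ q ∈ s, ∀ t : ℝ, 0 ≤ t →
      inner ℝ (Ψ q t) (Ψ' q t) ≤ K * ‖Ψ q t‖ * ∑ r ∈ s, ‖Ψ r t‖)
    {t : ℝ} (ht : 0 ≤ t) :
    ∑ q ∈ s, ‖Ψ q t‖ ≤ (∑ q ∈ s, ‖Ψ q 0‖) * Real.exp (K * s.card * t) := by
  set L : ℝ := K * s.card with hL
  have main : ∀ ε : ℝ, 0 < ε → ∑ q ∈ s, ‖Ψ q t‖ ≤
      (∑ q ∈ s, (‖Ψ q 0‖ + ε)) * Real.exp (L * t) := by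
    intro ε hε
    have hpos : ∀ q τ, 0 < ‖Ψ q τ‖ ^ 2 + ε ^ 2 := fun q τ => by positivity
    have hle : ∀ q τ, ‖Ψ q τ‖ ≤ √(‖Ψ q τ‖ ^ 2 + ε ^ 2) := fun q τ =>
      Real.le_sqrt_of_sq_le (by nlinarith)
    set N : ℝ → ℝ := fun τ => ∑ q ∈ s, √(‖Ψ q τ‖ ^ 2 + ε ^ 2) with hN
    set N' : ℝ → ℝ := fun τ => ∑ q ∈ s,
      (2 * inner ℝ (Ψ q τ) (Ψ' q τ)) / (2 * √(‖Ψ q τ‖ ^ 2 + ε ^ 2)) with hN'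
    have hder : ∀ τ, 0 ≤ τ → HasDerivWithinAt N (N' τ) (Set.Ici 0) τ := by
      intro τ hτ
      refine HasDerivWithinAt.fun_sum fun q hq => ?_
      exact ((hd q hq τ hτ).norm_sq.add_const (ε ^ 2)).sqrt (hpos q τ).ne'
    have hbound : ∀ τ, 0 ≤ τ → N' τ ≤ L * N τ := by
      intro τ hτ
      have h1 : ∀ q ∈ s, (2 * inner ℝ (Ψ q τ) (Ψ' q τ)) / (2 * √(‖Ψ q τ‖ ^ 2 + ε ^ 2)) ≤
          K * N τ := by
        intro q hq
        have hsp : 0 < √(‖Ψ q τ‖ ^ 2 + ε ^ 2) := Real.sqrt_pos.2 (hpos q τ)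
        have hsum : ∑ r ∈ s, ‖Ψ r τ‖ ≤ N τ := Finset.sum_le_sum fun r _ => hle r τ
        have hsum0 : 0 ≤ ∑ r ∈ s, ‖Ψ r τ‖ := Finset.sum_nonneg fun r _ => norm_nonneg _
        rw [mul_div_mul_left _ _ two_ne_zero, div_le_iff₀ hsp]
        calc _ ≤ K * ‖Ψ q τ‖ * ∑ r ∈ s, ‖Ψ r τ‖ := he q hq τ hτ
          _ ≤ K * √(‖Ψ q τ‖ ^ 2 + ε ^ 2) * N τ := by
            gcongr
            exact hle q τ
          _ = _ := by ring
      calc N' τ ≤ ∑ _q ∈ s, K * N τ := Finset.sum_le_sum h1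
        _ = L * N τ := by rw [Finset.sum_const, nsmul_eq_mul, hL]; ring
    have hexp : ∀ τ, HasDerivAt (fun τ => Real.exp (-(L * τ))) (Real.exp (-(L * τ)) * (-L)) τ :=
      fun τ => by simpa using (((hasDerivAt_id τ).const_mul L).neg).exp
    have hF : ∀ τ, 0 ≤ τ → HasDerivWithinAt (fun τ => Real.exp (-(L * τ)) * N τ)
        (Real.exp (-(L * τ)) * (-L) * N τ + Real.exp (-(L * τ)) * N' τ) (Set.Ici 0) τ :=
      fun τ hτ => (hexp τ).hasDerivWithinAt.mul (hder τ hτ)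
    have hanti : AntitoneOn (fun τ => Real.exp (-(L * τ)) * N τ) (Set.Ici 0) := by
      refine antitoneOn_of_hasDerivWithinAt_nonpos (convex_Ici 0)
        (fun τ hτ => (hF τ hτ).continuousWithinAt)
        (fun τ hτ => (hF τ (interior_subset hτ)).mono interior_subset) fun τ hτ => ?_
      have := hbound τ (interior_subset hτ)
      nlinarith [Real.exp_pos (-(L * τ))]
    have h0 := hanti (Set.mem_Ici.2 le_rfl) (Set.mem_Ici.2 ht) ht
    simp only [mul_zero, neg_zero, Real.exp_zero, one_mul] at h0
    have hN0 : N 0 ≤ ∑ q ∈ s, (‖Ψ q 0‖ + ε) := Finset.sum_le_sum fun q _ =>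
      (Real.sqrt_le_left (by positivity)).2 (by nlinarith [norm_nonneg (Ψ q 0)])
    calc ∑ q ∈ s, ‖Ψ q t‖ ≤ N t := Finset.sum_le_sum fun q _ => hle q t
      _ = Real.exp (-(L * t)) * N t * Real.exp (L * t) := by
        rw [mul_right_comm, ← Real.exp_add]; simp
      _ ≤ _ := by gcongr; exact h0.trans hN0
  have hlim : Filter.Tendsto (fun ε : ℝ => (∑ q ∈ s, (‖Ψ q 0‖ + ε)) * Real.exp (L * t))
      (nhdsWithin 0 (Set.Ioi 0)) (nhds ((∑ q ∈ s, (‖Ψ q 0‖ + 0)) * Real.exp (L * t))) := by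
    refine tendsto_nhdsWithin_of_tendsto_nhds (Continuous.tendsto ?_ 0)
    fun_prop
  simpa using ge_of_tendsto hlim (eventually_mem_nhdsWithin.mono fun ε hε => main ε hε)

section Schwartz

open scoped SchwartzMap LineDeriv

/-- Mixed derivative `∂_x^b ∂_y^β` on Schwartz functions of two real variables. -/
def schwartzD (b β : ℕ) (F : 𝓢(ℝ × ℝ, ℂ)) : 𝓢(ℝ × ℝ, ℂ) :=
  (fun G : 𝓢(ℝ × ℝ, ℂ) => ∂_{((1 : ℝ), (0 : ℝ))} G)^[b]
    ((fun G : 𝓢(ℝ × ℝ, ℂ) => ∂_{((0 : ℝ), (1 : ℝ))} G)^[β] F)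

lemma SchwartzMap.lineDerivOp_comm {E : Type*} [NormedAddCommGroup E] [NormedSpace ℝ E]
    (F : 𝓢(E, ℂ)) (v w : E) : ∂_{v} (∂_{w} F) = ∂_{w} (∂_{v} F) := by
  have key : ∀ (v w : E) (p : E), ∂_{v} (∂_{w} F) p = fderiv ℝ (fderiv ℝ F) p v w := by
    intro v w p
    have hd : DifferentiableAt ℝ (fderiv ℝ F) p :=
      ((F.smooth 2).fderiv_right (m := 1) (by norm_num)).differentiable (by norm_num) p
    rw [SchwartzMap.lineDerivOp_apply_eq_fderiv]
    have : ((∂_{w} F : 𝓢(E, ℂ)) : E → ℂ) = fun p => fderiv ℝ F p w := by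
      ext p; rw [SchwartzMap.lineDerivOp_apply_eq_fderiv]
    rw [this, fderiv_clm_apply hd (differentiableAt_const _)]
    simp
  ext p
  rw [key, key]
  exact ((F.smooth 2).contDiffAt.isSymmSndFDerivAt (by simp)).eq v w

lemma hasDerivAt_slice_fst (F : 𝓢(ℝ × ℝ, ℂ)) (x y : ℝ) :
    HasDerivAt (fun x' => F (x', y)) (∂_{((1 : ℝ), (0 : ℝ))} F (x, y)) x := by
  have h : HasDerivAt (fun x' : ℝ => (x', y)) ((1 : ℝ), (0 : ℝ)) x :=
    (hasDerivAt_id x).prodMk (hasDerivAt_const x y)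
  rw [SchwartzMap.lineDerivOp_apply_eq_fderiv]
  exact (F.hasFDerivAt (x, y)).comp_hasDerivAt x h

lemma hasDerivAt_slice_snd (F : 𝓢(ℝ × ℝ, ℂ)) (x y : ℝ) :
    HasDerivAt (fun y' => F (x, y')) (∂_{((0 : ℝ), (1 : ℝ))} F (x, y)) y := by
  have h : HasDerivAt (fun y' : ℝ => (x, y')) ((0 : ℝ), (1 : ℝ)) y :=
    (hasDerivAt_const y x).prodMk (hasDerivAt_id y)
  rw [SchwartzMap.lineDerivOp_apply_eq_fderiv]
  exact (F.hasFDerivAt (x, y)).comp_hasDerivAt y h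

lemma iteratedDeriv_slice_fst (n : ℕ) (F : 𝓢(ℝ × ℝ, ℂ)) (x y : ℝ) :
    iteratedDeriv n (fun x' => F (x', y)) x = schwartzD n 0 F (x, y) := by
  induction n generalizing F with
  | zero => rfl
  | succ n ih =>
    rw [iteratedDeriv_succ', funext fun x' => (hasDerivAt_slice_fst F x' y).deriv, ih]
    rfl

lemma iteratedDeriv_slice_snd (n : ℕ) (F : 𝓢(ℝ × ℝ, ℂ)) (x y : ℝ) :
    iteratedDeriv n (fun y' => F (x, y')) y = schwartzD 0 n F (x, y) := by
  induction n generalizing F with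
  | zero => rfl
  | succ n ih =>
    rw [iteratedDeriv_succ', funext fun y' => (hasDerivAt_slice_snd F x y').deriv, ih]
    rfl

lemma pd2_schwartz (b β : ℕ) (F : 𝓢(ℝ × ℝ, ℂ)) (x y : ℝ) :
    pd2 b β (fun x y => F (x, y)) x y = schwartzD b β F (x, y) := by
  simp only [pd2, iteratedDeriv_slice_snd, iteratedDeriv_slice_fst]
  rfl

lemma lineDerivOp_fst_schwartzD (b β : ℕ) (F : 𝓢(ℝ × ℝ, ℂ)) :
    ∂_{((1 : ℝ), (0 : ℝ))} (schwartzD b β F) = schwartzD (b + 1) β F := by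
  simp only [schwartzD, Function.iterate_succ_apply']

lemma lineDerivOp_snd_schwartzD (b β : ℕ) (F : 𝓢(ℝ × ℝ, ℂ)) :
    ∂_{((0 : ℝ), (1 : ℝ))} (schwartzD b β F) = schwartzD b (β + 1) F := by
  simp only [schwartzD, Function.iterate_succ_apply']
  have hc : Function.Commute (fun G : 𝓢(ℝ × ℝ, ℂ) => ∂_{((0 : ℝ), (1 : ℝ))} G)
      (fun G : 𝓢(ℝ × ℝ, ℂ) => ∂_{((1 : ℝ), (0 : ℝ))} G) :=
    fun G => SchwartzMap.lineDerivOp_comm G _ _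
  exact (hc.iterate_right b) _

lemma schwartzD_schwartzD_one_one (b β : ℕ) (F : 𝓢(ℝ × ℝ, ℂ)) :
    schwartzD b β (schwartzD 1 1 F) = schwartzD (b + 1) (β + 1) F := by
  have hy : schwartzD 0 β (schwartzD 1 1 F) = schwartzD 1 (β + 1) F := by
    induction β with
    | zero => rfl
    | succ β ih =>
      rw [← lineDerivOp_snd_schwartzD, ih, lineDerivOp_snd_schwartzD]
  induction b with
  | zero => exact hy
  | succ b ih => rw [← lineDerivOp_fst_schwartzD, ih, lineDerivOp_fst_schwartzD]

/-- The operator `i ∂_x ∂_y` is skew-symmetric for the real `L²` inner product. -/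
lemma integral_inner_I_mul_schwartzD_one_one (U : 𝓢(ℝ × ℝ, ℂ)) :
    Integrable (fun p => inner ℝ (U p) (Complex.I * schwartzD 1 1 U p)) ∧
      ∫ p, inner ℝ (U p) (Complex.I * schwartzD 1 1 U p) = 0 := by
  let L : ℂ →L[ℝ] ℂ →L[ℝ] ℝ :=
    ((innerSL ℝ : ℂ →L[ℝ] ℂ →L[ℝ] ℝ).flip ∘L (ContinuousLinearMap.mul ℝ ℂ Complex.I)).flip
  have hL : ∀ z w, L z w = inner ℝ z (Complex.I * w) := fun z w => rfl
  have hanti : ∀ z w, L z w = -L w z := by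
    intro z w
    simp only [hL, Complex.inner]
    simp
    ring
  have h1 := SchwartzMap.integral_bilinear_lineDerivOp_right_eq_neg_left (μ := volume) U
    (∂_{((0 : ℝ), (1 : ℝ))} U) L ((1 : ℝ), (0 : ℝ))
  have h2 := SchwartzMap.integral_bilinear_lineDerivOp_right_eq_neg_left (μ := volume) U
    (∂_{((1 : ℝ), (0 : ℝ))} U) L ((0 : ℝ), (1 : ℝ))
  rw [SchwartzMap.lineDerivOp_comm U ((0 : ℝ), (1 : ℝ))] at h2
  have h3 : ∫ p, L (∂_{((0 : ℝ), (1 : ℝ))} U p) (∂_{((1 : ℝ), (0 : ℝ))} U p) =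
      -∫ p, L (∂_{((1 : ℝ), (0 : ℝ))} U p) (∂_{((0 : ℝ), (1 : ℝ))} U p) := by
    rw [← integral_neg]
    exact integral_congr_ae (ae_of_all _ fun p => hanti _ _)
  have h4 : schwartzD 1 1 U = ∂_{((1 : ℝ), (0 : ℝ))} (∂_{((0 : ℝ), (1 : ℝ))} U) := rfl
  rw [h4]
  constructor
  · exact (SchwartzMap.bilinLeftCLM L (SchwartzMap.hasTemperateGrowth
      (∂_{((1 : ℝ), (0 : ℝ))} (∂_{((0 : ℝ), (1 : ℝ))} U))) U).integrable
  · change ∫ p, L (U p) _ = 0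
    linarith

/-- The weighted derivative `x^a ∂_x^b y^α ∂_y^β F` as a Schwartz function. -/
def schwartzWD (a b α β : ℕ) (F : 𝓢(ℝ × ℝ, ℂ)) : 𝓢(ℝ × ℝ, ℂ) :=
  SchwartzMap.smulLeftCLM ℂ (fun p : ℝ × ℝ => (p.1 : ℂ) ^ a * (p.2 : ℂ) ^ α) (schwartzD b β F)

lemma schwartzWD_apply (a b α β : ℕ) (F : 𝓢(ℝ × ℝ, ℂ)) (x y : ℝ) :
    schwartzWD a b α β F (x, y) = (x : ℂ) ^ a * (y : ℂ) ^ α * schwartzD b β F (x, y) := by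
  have h1 : (fun p : ℝ × ℝ => (p.1 : ℂ)).HasTemperateGrowth :=
    (Complex.ofRealCLM ∘L ContinuousLinearMap.fst ℝ ℝ ℝ).hasTemperateGrowth
  have h2 : (fun p : ℝ × ℝ => (p.2 : ℂ)).HasTemperateGrowth :=
    (Complex.ofRealCLM ∘L ContinuousLinearMap.snd ℝ ℝ ℝ).hasTemperateGrowth
  rw [schwartzWD, SchwartzMap.smulLeftCLM_apply_apply (by fun_prop)]
  rfl

lemma wD_schwartz (a b α β : ℕ) (F : 𝓢(ℝ × ℝ, ℂ)) (x y : ℝ) :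
    wD a b α β (fun x y => F (x, y)) x y = schwartzWD a b α β F (x, y) := by
  rw [wD, pd2_schwartz, schwartzWD_apply]

lemma schwartzD_one_one_schwartzWD (a b α β : ℕ) (F : 𝓢(ℝ × ℝ, ℂ)) (x y : ℝ) :
    schwartzD 1 1 (schwartzWD a b α β F) (x, y) =
      (x : ℂ) ^ a * (y : ℂ) ^ α * schwartzD (b + 1) (β + 1) F (x, y) +
      a * schwartzWD (a - 1) b α (β + 1) F (x, y) +
      α * schwartzWD a (b + 1) (α - 1) β F (x, y) +
      a * α * schwartzWD (a - 1) b (α - 1) β F (x, y) := by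
  have hpow : ∀ (n : ℕ) (s : ℝ),
      HasDerivAt (fun s : ℝ => (s : ℂ) ^ n) ((n : ℂ) * (s : ℂ) ^ (n - 1)) s := fun n s => by
    simpa using (Complex.ofRealCLM.hasDerivAt (x := s)).fun_pow n
  have hy : ∀ x y : ℝ, ∂_{((0 : ℝ), (1 : ℝ))} (schwartzWD a b α β F) (x, y) =
      (x : ℂ) ^ a * (α * (y : ℂ) ^ (α - 1) * schwartzD b β F (x, y) +
        (y : ℂ) ^ α * schwartzD b (β + 1) F (x, y)) := by
    intro x y
    refine (hasDerivAt_slice_snd (schwartzWD a b α β F) x y).unique ?_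
    simp only [schwartzWD_apply, mul_assoc]
    have := ((hpow α y).fun_mul
      (hasDerivAt_slice_snd (schwartzD b β F) x y)).const_mul ((x : ℂ) ^ a)
    rw [lineDerivOp_snd_schwartzD] at this
    simpa only [mul_assoc] using this
  change ∂_{((1 : ℝ), (0 : ℝ))} (∂_{((0 : ℝ), (1 : ℝ))} (schwartzWD a b α β F)) (x, y) = _
  have hx := hasDerivAt_slice_fst (∂_{((0 : ℝ), (1 : ℝ))} (schwartzWD a b α β F)) x y
  simp only [hy] at hx
  have h1 := hasDerivAt_slice_fst (schwartzD b β F) x y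
  have h2 := hasDerivAt_slice_fst (schwartzD b (β + 1) F) x y
  rw [lineDerivOp_fst_schwartzD] at h1 h2
  rw [hx.unique ((hpow a x).mul ((h1.const_mul ((α : ℂ) * (y : ℂ) ^ (α - 1))).add
    (h2.const_mul ((y : ℂ) ^ α))))]
  simp only [schwartzWD_apply]
  ring

end Schwartz

lemma iteratedDeriv_mul_slice (β : ℕ) (E f : ℝ → ℝ → ℂ) (x y : ℝ)
    (hE : ContDiff ℝ β (E x)) (hf : ContDiff ℝ β (f x)) :
    iteratedDeriv β (fun y => E x y * f x y) y =
      ∑ k ∈ Finset.range (β + 1), (β.choose k : ℂ) *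
        (iteratedDeriv k (E x) y * iteratedDeriv (β - k) (f x) y) := by
  rw [iteratedDeriv_fun_mul hE.contDiffAt hf.contDiffAt]
  simp only [mul_assoc]

lemma contDiff_iteratedDeriv_mul_slice {b β : ℕ} {E f : ℝ → ℝ → ℂ} {y : ℝ}
    (hE : ∀ x, ContDiff ℝ β (E x)) (hf : ∀ x, ContDiff ℝ β (f x))
    (hEx : ∀ k ≤ β, ContDiff ℝ b (fun x => iteratedDeriv k (E x) y))
    (hfx : ∀ k ≤ β, ContDiff ℝ b (fun x => iteratedDeriv k (f x) y)) :
    ContDiff ℝ b (fun x => iteratedDeriv β (fun y => E x y * f x y) y) := by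
  simp only [fun x => iteratedDeriv_mul_slice β E f x y (hE x) (hf x)]
  exact ContDiff.sum fun k hk => contDiff_const.mul
    ((hEx k (Nat.lt_succ_iff.1 (Finset.mem_range.1 hk))).mul (hfx (β - k) (Nat.sub_le _ _)))

/-- Leibniz rule for `∂_x^b ∂_y^β` applied to a product. -/
lemma pd2_mul {b β : ℕ} {E f : ℝ → ℝ → ℂ} {y : ℝ}
    (hE : ∀ x, ContDiff ℝ β (E x)) (hf : ∀ x, ContDiff ℝ β (f x))
    (hEx : ∀ k ≤ β, ContDiff ℝ b (fun x => iteratedDeriv k (E x) y))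
    (hfx : ∀ k ≤ β, ContDiff ℝ b (fun x => iteratedDeriv k (f x) y)) (x : ℝ) :
    pd2 b β (fun x y => E x y * f x y) x y =
      ∑ k ∈ Finset.range (β + 1), ∑ j ∈ Finset.range (b + 1),
        (β.choose k : ℂ) * (b.choose j : ℂ) * pd2 j k E x y * pd2 (b - j) (β - k) f x y := by
  have hk : ∀ k ∈ Finset.range (β + 1), k ≤ β := fun k hk => by
    simpa [Nat.lt_succ_iff] using hk
  simp only [pd2, fun x => iteratedDeriv_mul_slice β E f x y (hE x) (hf x)]
  rw [iteratedDeriv_fun_sum fun k h => (contDiff_const.mul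
    ((hEx k (hk k h)).mul (hfx (β - k) (Nat.sub_le _ _)))).contDiffAt]
  refine Finset.sum_congr rfl fun k h => ?_
  rw [iteratedDeriv_const_mul_field, iteratedDeriv_fun_mul (hEx k (hk k h)).contDiffAt
    (hfx (β - k) (Nat.sub_le _ _)).contDiffAt, Finset.mul_sum]
  simp only [mul_assoc]

lemma contDiff_iteratedDeriv {W : ℝ → ℂ} {n k : ℕ} (hW : ContDiff ℝ (n + k : ℕ) W) :
    ContDiff ℝ n (iteratedDeriv k W) := by
  rw [iteratedDeriv_eq_iterate]
  exact ContDiff.iterate_deriv' n k (by exact_mod_cast hW)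

lemma contDiff_diffQuot {W : ℝ → ℂ} {n : ℕ} (hW : ContDiff ℝ n W) (h : ℂ) (c x : ℝ) :
    ContDiff ℝ n (fun y => (W (x + c * y) - W (x - c * y)) / h) := by
  fun_prop

/-- Iterated `y`-derivatives of the difference quotient of `W`. -/
lemma iteratedDeriv_diffQuot {W : ℝ → ℂ} {k : ℕ} (hW : ContDiff ℝ k W) (h : ℂ) (c x y : ℝ) :
    iteratedDeriv k (fun y => (W (x + c * y) - W (x - c * y)) / h) y =
      ((c : ℂ) ^ k * iteratedDeriv k W (x + c * y) -
        (-c : ℂ) ^ k * iteratedDeriv k W (x - c * y)) / h := by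
  have key : ∀ c : ℝ, iteratedDeriv k (fun y => W (x + c * y)) y =
      (c : ℂ) ^ k * iteratedDeriv k W (x + c * y) := by
    intro c
    have hW' : ContDiff ℝ k (fun z => W (x + z)) := by fun_prop
    rw [iteratedDeriv_comp_const_smul hW', iteratedDeriv_comp_const_add]
    simp
  have h2 : (fun y => W (x - c * y)) = fun y => W (x + (-c) * y) := by
    funext y; congr 1; ring
  have hs : ∀ c : ℝ, ContDiffAt ℝ k (fun y => W (x + c * y)) y := fun c => by
    have : ContDiff ℝ k (fun y => W (x + c * y)) := by fun_prop
    exact this.contDiffAt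
  rw [iteratedDeriv_div_const, iteratedDeriv_fun_sub (hs c) (by rw [h2]; exact hs _), key, h2, key]
  simp [sub_eq_add_neg]

/-- Mixed derivatives of the difference quotient of `W`. -/
lemma pd2_diffQuot {W : ℝ → ℂ} {j k : ℕ} (hW : ContDiff ℝ (j + k : ℕ) W) (h : ℂ) (c x y : ℝ) :
    pd2 j k (fun x y => (W (x + c * y) - W (x - c * y)) / h) x y =
      ((c : ℂ) ^ k * iteratedDeriv (j + k) W (x + c * y) -
        (-c : ℂ) ^ k * iteratedDeriv (j + k) W (x - c * y)) / h := by
  have hk : ContDiff ℝ k W := hW.of_le (by exact_mod_cast Nat.le_add_left _ _)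
  have hD : ContDiff ℝ j (iteratedDeriv k W) := contDiff_iteratedDeriv hW
  have hcomp : iteratedDeriv j (iteratedDeriv k W) = iteratedDeriv (j + k) W := by
    simp only [iteratedDeriv_eq_iterate, Function.iterate_add_apply]
  have hp : ContDiffAt ℝ j (fun x => (c : ℂ) ^ k * iteratedDeriv k W (x + c * y)) x := by
    have : ContDiff ℝ j (fun x => (c : ℂ) ^ k * iteratedDeriv k W (x + c * y)) := by fun_prop
    exact this.contDiffAt
  have hm : ContDiffAt ℝ j (fun x => (-c : ℂ) ^ k * iteratedDeriv k W (x - c * y)) x := by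
    have : ContDiff ℝ j (fun x => (-c : ℂ) ^ k * iteratedDeriv k W (x - c * y)) := by fun_prop
    exact this.contDiffAt
  simp only [pd2, iteratedDeriv_diffQuot hk]
  rw [iteratedDeriv_div_const, iteratedDeriv_fun_sub hp hm, iteratedDeriv_const_mul_field,
    iteratedDeriv_const_mul_field, iteratedDeriv_comp_add_const, iteratedDeriv_comp_sub_const,
    hcomp]

lemma iteratedDeriv_ofReal_comp {V : ℝ → ℝ} {n : ℕ} (hV : ContDiff ℝ n V) (x : ℝ) :
    iteratedDeriv n (fun x => (V x : ℂ)) x =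
      ((iteratedDeriv n V x : ℝ) : ℂ) := by
  induction n generalizing x with
  | zero => simp
  | succ n ih =>
    have hd : DifferentiableAt ℝ (iteratedDeriv n V) x :=
      hV.differentiable_iteratedDeriv n (by exact_mod_cast n.lt_succ_self) x
    rw [iteratedDeriv_succ, iteratedDeriv_succ,
      funext (ih (hV.of_le (by exact_mod_cast n.le_succ)))]
    exact hd.hasDerivAt.ofReal_comp.deriv

/-- The multi-indices `(a, b, α, β)` of order at most `m`. -/
def multiIndices (m : ℕ) : Finset (ℕ × ℕ × ℕ × ℕ) :=
  Finset.filter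
      (fun q : ℕ × ℕ × ℕ × ℕ => q.1 + q.2.1 + q.2.2.1 + q.2.2.2 ≤ m)
      (Finset.range (m+1) ×ˢ Finset.range (m+1) ×ˢ Finset.range (m+1) ×ˢ Finset.range (m+1))

lemma mem_multiIndices {m a b α β : ℕ} :
    (a, b, α, β) ∈ multiIndices m ↔ a + b + α + β ≤ m := by
  simp only [multiIndices, Finset.mem_filter, Finset.mem_product, Finset.mem_range]
  omega

section Pointwise

open scoped SchwartzMap

/-- The pointwise sum of all weighted derivatives of order at most `m`. -/
def weightedSum (m : ℕ) (F : 𝓢(ℝ × ℝ, ℂ)) (p : ℝ × ℝ) : ℝ :=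
  ∑ q ∈ multiIndices m, ‖schwartzWD q.1 q.2.1 q.2.2.1 q.2.2.2 F p‖

lemma weightedSum_nonneg (m : ℕ) (F : 𝓢(ℝ × ℝ, ℂ)) (p : ℝ × ℝ) : 0 ≤ weightedSum m F p :=
  Finset.sum_nonneg fun _ _ => norm_nonneg _

lemma norm_schwartzWD_le {m a b α β : ℕ} (h : a + b + α + β ≤ m) (F : 𝓢(ℝ × ℝ, ℂ)) (p : ℝ × ℝ) :
    ‖schwartzWD a b α β F p‖ ≤ weightedSum m F p := by
  have hq : (a, b, α, β) ∈ multiIndices m := mem_multiIndices.2 h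
  have := Finset.single_le_sum (f := fun q : ℕ × ℕ × ℕ × ℕ =>
    ‖schwartzWD q.1 q.2.1 q.2.2.1 q.2.2.2 F p‖) (fun _ _ => norm_nonneg _) hq
  exact this

lemma norm_commutator_le {m a b α β : ℕ} (h : a + b + α + β ≤ m) (F : 𝓢(ℝ × ℝ, ℂ)) (p : ℝ × ℝ) :
    ‖(a : ℂ) * schwartzWD (a - 1) b α (β + 1) F p + α * schwartzWD a (b + 1) (α - 1) β F p +
      a * α * schwartzWD (a - 1) b (α - 1) β F p‖ ≤ (2 * m + m ^ 2) * weightedSum m F p := by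
  have ha : (a : ℝ) ≤ m := by exact_mod_cast (by omega : a ≤ m)
  have hα : (α : ℝ) ≤ m := by exact_mod_cast (by omega : α ≤ m)
  have hP := weightedSum_nonneg m F p
  have h1 : ‖(a : ℂ) * schwartzWD (a - 1) b α (β + 1) F p‖ ≤ m * weightedSum m F p := by
    rcases Nat.eq_zero_or_pos a with rfl | h0
    · simp only [Nat.cast_zero, zero_mul, norm_zero]; positivity
    · rw [norm_mul, Complex.norm_natCast]
      gcongr
      exact norm_schwartzWD_le (by omega) F p
  have h2 : ‖(α : ℂ) * schwartzWD a (b + 1) (α - 1) β F p‖ ≤ m * weightedSum m F p := by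
    rcases Nat.eq_zero_or_pos α with rfl | h0
    · simp only [Nat.cast_zero, zero_mul, norm_zero]; positivity
    · rw [norm_mul, Complex.norm_natCast]
      gcongr
      exact norm_schwartzWD_le (by omega) F p
  have h3 : ‖(a : ℂ) * α * schwartzWD (a - 1) b (α - 1) β F p‖ ≤
      m * m * weightedSum m F p := by
    rw [norm_mul, norm_mul, Complex.norm_natCast, Complex.norm_natCast]
    gcongr
    exact norm_schwartzWD_le (by omega) F p
  calc _ ≤ _ := norm_add₃_le
    _ ≤ m * weightedSum m F p + m * weightedSum m F p + m * m * weightedSum m F p := by gcongr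
    _ = _ := by ring

lemma growth_mul_norm_schwartzWD_le {m a b α β : ℕ} (h : a + b + α + β + 1 ≤ m)
    (F : 𝓢(ℝ × ℝ, ℂ)) (x y : ℝ) :
    (1 + |x| + |y|) * ‖schwartzWD a b α β F (x, y)‖ ≤ 3 * weightedSum m F (x, y) := by
  have h0 := norm_schwartzWD_le (m := m) (by omega : a + b + α + β ≤ m) F (x, y)
  have h1 := norm_schwartzWD_le (m := m) (by omega : a + 1 + b + α + β ≤ m) F (x, y)
  have h2 := norm_schwartzWD_le (m := m) (by omega : a + b + (α + 1) + β ≤ m) F (x, y)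
  have e1 : ‖schwartzWD (a + 1) b α β F (x, y)‖ = |x| * ‖schwartzWD a b α β F (x, y)‖ := by
    simp only [schwartzWD_apply, norm_mul, norm_pow, Complex.norm_real, Real.norm_eq_abs]; ring
  have e2 : ‖schwartzWD a b (α + 1) β F (x, y)‖ = |y| * ‖schwartzWD a b α β F (x, y)‖ := by
    simp only [schwartzWD_apply, norm_mul, norm_pow, Complex.norm_real, Real.norm_eq_abs]; ring
  rw [e1] at h1
  rw [e2] at h2
  linarith

lemma contDiff_slice_snd (F : 𝓢(ℝ × ℝ, ℂ)) (n : ℕ) (x : ℝ) :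
    ContDiff ℝ n (fun y => F (x, y)) :=
  (F.smooth n).comp (contDiff_const.prodMk contDiff_id)

lemma contDiff_slice_fst (F : 𝓢(ℝ × ℝ, ℂ)) (n : ℕ) (y : ℝ) :
    ContDiff ℝ n (fun x => F (x, y)) :=
  (F.smooth n).comp (contDiff_id.prodMk contDiff_const)

lemma contDiff_iteratedDeriv_slice (F : 𝓢(ℝ × ℝ, ℂ)) (n k : ℕ) (y : ℝ) :
    ContDiff ℝ n (fun x => iteratedDeriv k (fun y => F (x, y)) y) := by
  simp only [iteratedDeriv_slice_snd]
  exact contDiff_slice_fst _ n y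

/-- The commutator of a weighted derivative with multiplication by `E` is controlled by weighted
derivatives of order at most `m`, if the derivatives of `E` grow at most linearly. -/
lemma norm_wD_mul_sub_le {m a b α β : ℕ} (h : a + b + α + β ≤ m) (F : 𝓢(ℝ × ℝ, ℂ))
    {E : ℝ → ℝ → ℂ} {B : ℝ} (hB : 0 ≤ B) (x y : ℝ)
    (hE : ∀ x, ContDiff ℝ β (E x))
    (hEx : ∀ k ≤ β, ContDiff ℝ b (fun x => iteratedDeriv k (E x) y))
    (hbd : ∀ j k : ℕ, 1 ≤ j + k → j + k ≤ m → ‖pd2 j k E x y‖ ≤ B * (1 + |x| + |y|)) :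
    ‖wD a b α β (fun x y => E x y * F (x, y)) x y - E x y * schwartzWD a b α β F (x, y)‖ ≤
      (m + 1) ^ 2 * (2 ^ m * 2 ^ m * (3 * B)) * weightedSum m F (x, y) := by
  have hP := weightedSum_nonneg m F (x, y)
  let T : ℕ × ℕ → ℂ := fun q => (β.choose q.1 : ℂ) * (b.choose q.2 : ℂ) * pd2 q.2 q.1 E x y *
    schwartzWD a (b - q.2) α (β - q.1) F (x, y)
  have hsum : wD a b α β (fun x y => E x y * F (x, y)) x y =
      ∑ q ∈ Finset.range (β + 1) ×ˢ Finset.range (b + 1), T q := by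
    rw [wD, pd2_mul (f := fun x y => F (x, y)) hE (contDiff_slice_snd F β) hEx
      fun k _ => contDiff_iteratedDeriv_slice F b k y]
    simp only [Finset.sum_product, Finset.mul_sum, pd2_schwartz, T, schwartzWD_apply]
    refine Finset.sum_congr rfl fun k _ => Finset.sum_congr rfl fun j _ => ?_
    ring
  have hT0 : T (0, 0) = E x y * schwartzWD a b α β F (x, y) := by
    simp [T, pd2]
  have hmem : (0, 0) ∈ Finset.range (β + 1) ×ˢ Finset.range (b + 1) := by simp
  rw [hsum, ← Finset.add_sum_erase _ _ hmem, hT0, add_sub_cancel_left]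
  have hchoose : ∀ n k : ℕ, n ≤ m → (n.choose k : ℝ) ≤ 2 ^ m := fun n k hn => by
    exact_mod_cast (Nat.choose_le_two_pow n k).trans (Nat.pow_le_pow_right two_pos hn)
  have hT : ∀ q ∈ (Finset.range (β + 1) ×ˢ Finset.range (b + 1)).erase (0, 0),
      ‖T q‖ ≤ 2 ^ m * 2 ^ m * (3 * B) * weightedSum m F (x, y) := by
    rintro ⟨k, j⟩ hq
    simp only [Finset.mem_erase, Finset.mem_product, Finset.mem_range, ne_eq, Prod.mk.injEq] at hq
    have hg := growth_mul_norm_schwartzWD_le (m := m) (a := a) (b := b - j) (α := α) (β := β - k)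
      (by omega) F x y
    have hb := hbd j k (by omega) (by omega)
    simp only [T, norm_mul, Complex.norm_natCast]
    calc _ ≤ 2 ^ m * 2 ^ m * (B * (1 + |x| + |y|)) *
          ‖schwartzWD a (b - j) α (β - k) F (x, y)‖ := by
          gcongr
          · exact hchoose _ _ (by omega)
          · exact hchoose _ _ (by omega)
      _ = 2 ^ m * 2 ^ m * B * ((1 + |x| + |y|) *
          ‖schwartzWD a (b - j) α (β - k) F (x, y)‖) := by ring
      _ ≤ 2 ^ m * 2 ^ m * B * (3 * weightedSum m F (x, y)) := by gcongr
      _ = _ := by ring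
  have hcard : (((Finset.range (β + 1) ×ˢ Finset.range (b + 1)).erase (0, 0)).card : ℝ) ≤
      (m + 1) ^ 2 := by
    have h1 : ((Finset.range (β + 1) ×ˢ Finset.range (b + 1)).erase (0, 0)).card ≤
        (m + 1) ^ 2 := by
      refine (Finset.card_erase_le).trans ?_
      rw [Finset.card_product, Finset.card_range, Finset.card_range, sq]
      exact Nat.mul_le_mul (by omega) (by omega)
    exact_mod_cast h1
  calc _ ≤ ∑ q ∈ (Finset.range (β + 1) ×ˢ Finset.range (b + 1)).erase (0, 0),
        2 ^ m * 2 ^ m * (3 * B) * weightedSum m F (x, y) := norm_sum_le_of_le _ hT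
    _ ≤ (m + 1) ^ 2 * (2 ^ m * 2 ^ m * (3 * B) * weightedSum m F (x, y)) := by
        rw [Finset.sum_const, nsmul_eq_mul]
        gcongr
    _ = _ := by ring

/-- Weighted derivatives of the right-hand side of the equation are, up to controlled terms, the
right-hand side applied to the weighted derivative. -/
lemma norm_wD_generator_sub_le {m a b α β : ℕ} (h : a + b + α + β ≤ m) (F : 𝓢(ℝ × ℝ, ℂ))
    {E : ℝ → ℝ → ℂ} {B : ℝ} (hB : 0 ≤ B) (x y : ℝ)
    (hE : ∀ x, ContDiff ℝ β (E x))
    (hEx : ∀ k ≤ β, ContDiff ℝ b (fun x => iteratedDeriv k (E x) y))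
    (hbd : ∀ j k : ℕ, 1 ≤ j + k → j + k ≤ m → ‖pd2 j k E x y‖ ≤ B * (1 + |x| + |y|)) :
    ‖wD a b α β (fun x y => Complex.I * pd2 1 1 (fun x y => F (x, y)) x y -
        Complex.I * E x y * F (x, y)) x y -
      (Complex.I * schwartzD 1 1 (schwartzWD a b α β F) (x, y) -
        Complex.I * (E x y * schwartzWD a b α β F (x, y)))‖ ≤
      (2 * m + m ^ 2 + (m + 1) ^ 2 * (2 ^ m * 2 ^ m * (3 * B))) * weightedSum m F (x, y) := by
  have hlin : pd2 b β (fun x y => Complex.I * pd2 1 1 (fun x y => F (x, y)) x y -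
        Complex.I * E x y * F (x, y)) x y =
      Complex.I * schwartzD (b + 1) (β + 1) F (x, y) -
        Complex.I * pd2 b β (fun x y => E x y * F (x, y)) x y := by
    simp only [pd2_schwartz, mul_assoc]
    rw [← schwartzD_schwartzD_one_one b β F, ← pd2_schwartz b β (schwartzD 1 1 F)]
    have hG : ContDiff ℝ b
        (fun x => iteratedDeriv β (fun y => schwartzD 1 1 F (x, y)) y) :=
      contDiff_iteratedDeriv_slice _ b β y
    have hEF : ContDiff ℝ b (fun x => iteratedDeriv β (fun y => E x y * F (x, y)) y) :=
      contDiff_iteratedDeriv_mul_slice (f := fun x y => F (x, y)) hE (contDiff_slice_snd F β) hEx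
        fun k _ => contDiff_iteratedDeriv_slice F b k y
    have hy : ∀ x, iteratedDeriv β (fun y => Complex.I * schwartzD 1 1 F (x, y) -
        Complex.I * (E x y * F (x, y))) y =
        Complex.I * iteratedDeriv β (fun y => schwartzD 1 1 F (x, y)) y -
          Complex.I * iteratedDeriv β (fun y => E x y * F (x, y)) y := fun x => by
      rw [iteratedDeriv_fun_sub
        (contDiff_const.mul (contDiff_slice_snd _ β x)).contDiffAt
        (contDiff_const.mul ((hE x).mul (contDiff_slice_snd F β x))).contDiffAt,
        iteratedDeriv_const_mul_field, iteratedDeriv_const_mul_field]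
    simp only [pd2, hy]
    rw [iteratedDeriv_fun_sub (contDiff_const.mul hG).contDiffAt
      (contDiff_const.mul hEF).contDiffAt,
      iteratedDeriv_const_mul_field, iteratedDeriv_const_mul_field]
  have h1 := norm_commutator_le h F (x, y)
  have h2 := norm_wD_mul_sub_le h F hB x y hE hEx hbd
  rw [wD] at h2
  have hI : ∀ z : ℂ, ‖Complex.I * z‖ = ‖z‖ := fun z => by simp
  rw [wD, hlin, schwartzD_one_one_schwartzWD, add_mul]
  rw [← hI] at h1 h2
  rw [← norm_neg] at h1
  refine (le_of_eq_of_le (congrArg norm ?_) (norm_sub_le _ _)).trans <| add_le_add h1 h2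
  ring

end Pointwise

section PotentialBounds

variable {m : ℕ} {V : ℝ → ℝ}

/-- The derivatives of order `1, …, m` of `V` are uniformly Lipschitz and grow at most linearly. -/
lemma exists_iteratedDeriv_bound (hV : ContDiff ℝ (m + 1) V)
    (hVb : ∀ n : ℕ, 2 ≤ n → n ≤ m + 1 → ∃ C : ℝ, ∀ x : ℝ, |iteratedDeriv n V x| ≤ C) :
    ∃ M : ℝ, 0 ≤ M ∧ ∀ n : ℕ, 1 ≤ n → n ≤ m →
      (∀ z w, |iteratedDeriv n V z - iteratedDeriv n V w| ≤ M * |z - w|) ∧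
      ∀ z, |iteratedDeriv n V z| ≤ M * (1 + |z|) := by
  have hC : ∀ n : ℕ, ∃ C : ℝ, 2 ≤ n → n ≤ m + 1 → ∀ x : ℝ, |iteratedDeriv n V x| ≤ C := by
    intro n
    by_cases h : 2 ≤ n ∧ n ≤ m + 1
    · obtain ⟨C, hC⟩ := hVb n h.1 h.2
      exact ⟨C, fun _ _ => hC⟩
    · exact ⟨0, fun h1 h2 => absurd ⟨h1, h2⟩ h⟩
  choose C hC using hC
  let c : ℕ → ℝ := fun n => |C (n + 1)| + |iteratedDeriv n V 0|
  have hc : ∀ n, 0 ≤ c n := fun n => by positivity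
  refine ⟨∑ n ∈ Finset.range (m + 1), c n, Finset.sum_nonneg fun n _ => hc n,
    fun n h1 h2 => ?_⟩
  have hn : c n ≤ ∑ n ∈ Finset.range (m + 1), c n :=
    Finset.single_le_sum (f := c) (fun n _ => hc n) (by simp; omega)
  set M := ∑ n ∈ Finset.range (m + 1), c n
  have hCM : C (n + 1) ≤ M :=
    ((le_abs_self _).trans (le_add_of_nonneg_right (abs_nonneg _))).trans hn
  have h0M : |iteratedDeriv n V 0| ≤ M := (le_add_of_nonneg_left (abs_nonneg _)).trans hn
  have hlip : ∀ z w, |iteratedDeriv n V z - iteratedDeriv n V w| ≤ M * |z - w| := by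
    intro z w
    have hd : ∀ x ∈ Set.univ, DifferentiableAt ℝ (iteratedDeriv n V) x := fun x _ =>
      hV.differentiable_iteratedDeriv n (by exact_mod_cast Nat.lt_succ_of_le h2) x
    have hb : ∀ x ∈ Set.univ, ‖deriv (iteratedDeriv n V) x‖ ≤ M := fun x _ => by
      rw [← iteratedDeriv_succ, Real.norm_eq_abs]
      exact (hC (n + 1) (by omega) (by omega) x).trans hCM
    exact convex_univ.norm_image_sub_le_of_norm_deriv_le hd hb (Set.mem_univ w) (Set.mem_univ z)
  refine ⟨hlip, fun z => ?_⟩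
  have h3 := hlip z 0
  rw [sub_zero] at h3
  have h4 := abs_sub_abs_le_abs_sub (iteratedDeriv n V z) (iteratedDeriv n V 0)
  linarith

/-- The potential of the von Neumann equation as a difference quotient of a complex function. -/
lemma ofReal_diffQuot (hbar x y : ℝ) :
    (((V (x + hbar * y / 2) - V (x - hbar * y / 2)) / hbar : ℝ) : ℂ) =
      ((fun x => (V x : ℂ)) (x + hbar / 2 * y) - (fun x => (V x : ℂ)) (x - hbar / 2 * y)) /
        (hbar : ℂ) := by
  have : hbar * y / 2 = hbar / 2 * y := by ring
  simp [this]

lemma norm_pd2_diffQuot_le (hV : ContDiff ℝ (m + 1) V) {M : ℝ} (hM : 0 ≤ M)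
    (hVM : ∀ n : ℕ, 1 ≤ n → n ≤ m →
      (∀ z w, |iteratedDeriv n V z - iteratedDeriv n V w| ≤ M * |z - w|) ∧
      ∀ z, |iteratedDeriv n V z| ≤ M * (1 + |z|))
    {hbar : ℝ} (h0 : 0 < hbar) (h1 : hbar ≤ 1) {j k : ℕ} (hjk : 1 ≤ j + k) (hjk' : j + k ≤ m)
    (x y : ℝ) :
    ‖pd2 j k (fun x y =>
      (((V (x + hbar * y / 2) - V (x - hbar * y / 2)) / hbar : ℝ) : ℂ)) x y‖ ≤
      M * (1 + |x| + |y|) := by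
  have hVn : ContDiff ℝ (j + k : ℕ) V := hV.of_le (by exact_mod_cast Nat.le_succ_of_le hjk')
  have hW : ContDiff ℝ (j + k : ℕ) (fun x => (V x : ℂ)) := Complex.ofRealCLM.contDiff.comp hVn
  obtain ⟨hlip, hgr⟩ := hVM (j + k) hjk hjk'
  simp only [ofReal_diffQuot]
  rw [pd2_diffQuot hW, iteratedDeriv_ofReal_comp hVn, iteratedDeriv_ofReal_comp hVn]
  set c := hbar / 2 with hc
  have hc0 : 0 < c := by positivity
  rw [norm_div, Complex.norm_real, Real.norm_of_nonneg h0.le, div_le_iff₀ h0]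
  rcases Nat.eq_zero_or_pos k with rfl | hk
  · have h2 := hlip (x + c * y) (x - c * y)
    have h3 : |x + c * y - (x - c * y)| = hbar * |y| := by
      rw [show x + c * y - (x - c * y) = hbar * y by rw [hc]; ring, abs_mul, abs_of_pos h0]
    rw [h3] at h2
    simp only [pow_zero, one_mul]
    rw [← Complex.ofReal_sub, Complex.norm_real, Real.norm_eq_abs]
    refine h2.trans ?_
    have : M * (1 + |x| + |y|) * hbar = M * (hbar * |y|) + M * hbar * (1 + |x|) := by ring
    rw [this]
    have : 0 ≤ M * hbar * (1 + |x|) := by positivity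
    linarith
  · have hck : c ^ k ≤ c := by
      simpa using pow_le_pow_of_le_one hc0.le (by rw [hc]; linarith) hk
    have hcy : c * |y| ≤ |y| := by nlinarith [abs_nonneg y]
    have habs : |c * y| = c * |y| := by rw [abs_mul, abs_of_pos hc0]
    have hp : |iteratedDeriv (j + k) V (x + c * y)| ≤ M * (1 + |x| + |y|) := by
      refine (hgr _).trans ?_
      have := abs_add_le x (c * y)
      exact mul_le_mul_of_nonneg_left (by linarith) hM
    have hm : |iteratedDeriv (j + k) V (x - c * y)| ≤ M * (1 + |x| + |y|) := by
      refine (hgr _).trans ?_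
      have := abs_sub x (c * y)
      exact mul_le_mul_of_nonneg_left (by linarith) hM
    refine (norm_sub_le _ _).trans ?_
    simp only [norm_mul, norm_pow, norm_neg, Complex.norm_real, Real.norm_eq_abs, abs_of_pos hc0]
    calc _ ≤ c * (M * (1 + |x| + |y|)) + c * (M * (1 + |x| + |y|)) := by gcongr
      _ = _ := by rw [hc]; ring

end PotentialBounds

section Energy

open scoped SchwartzMap

lemma integral_norm_mul_norm_le {α : Type*} [MeasurableSpace α] {μ : Measure α} (A B : Lp ℂ 2 μ) :
    Integrable (fun p => ‖A p‖ * ‖B p‖) μ ∧ ∫ p, ‖A p‖ * ‖B p‖ ∂μ ≤ ‖A‖ * ‖B‖ := by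
  let N : Lp ℂ 2 μ → Lp ℝ 2 μ := fun A => (Lp.memLp A).norm.toLp
  have hN : ∀ A, N A =ᵐ[μ] fun p => ‖A p‖ := fun A => MemLp.coeFn_toLp _
  have hnorm : ∀ A, ‖N A‖ = ‖A‖ := fun A => by
    rw [Lp.norm_toLp, eLpNorm_norm, Lp.norm_def]
  have hae : (fun p => inner ℝ (N A p) (N B p)) =ᵐ[μ] fun p => ‖A p‖ * ‖B p‖ := by
    filter_upwards [hN A, hN B] with p h1 h2
    rw [h1, h2]
    simp [mul_comm]
  refine ⟨(L2.integrable_inner (𝕜 := ℝ) (N A) (N B)).congr hae, ?_⟩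
  rw [← integral_congr_ae hae, ← L2.inner_def, ← hnorm A, ← hnorm B]
  exact real_inner_le_norm _ _

/-- Energy estimate at a fixed time: a real potential and `i ∂_x ∂_y` do not contribute. -/
lemma inner_le_of_norm_sub_le {ι : Type*} (s : Finset ι) (U : 𝓢(ℝ × ℝ, ℂ))
    (u : ι → ℝ × ℝ → ℂ) (e : ℝ × ℝ → ℝ) (w : ℝ × ℝ → ℂ) {K : ℝ} (hK : 0 ≤ K)
    (hw : ∀ p, ‖w p - (Complex.I * schwartzD 1 1 U p - Complex.I * (e p * U p))‖ ≤
      K * ∑ r ∈ s, ‖u r p‖)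
    (A B : Lp ℂ 2 (volume : Measure (ℝ × ℝ))) (Φ : ι → Lp ℂ 2 (volume : Measure (ℝ × ℝ)))
    (hA : A =ᵐ[volume] U) (hB : B =ᵐ[volume] w) (hΦ : ∀ r ∈ s, Φ r =ᵐ[volume] u r) :
    inner ℝ A B ≤ K * ‖A‖ * ∑ r ∈ s, ‖Φ r‖ := by
  obtain ⟨hI, hI0⟩ := integral_inner_I_mul_schwartzD_one_one U
  have hΦ' : ∀ᵐ p, ∀ r ∈ s, Φ r p = u r p := by
    rw [Filter.eventually_all_finset]
    exact hΦ
  have hpt : ∀ᵐ p, inner ℝ (A p) (B p) ≤ inner ℝ (U p) (Complex.I * schwartzD 1 1 U p) +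
      K * ∑ r ∈ s, ‖A p‖ * ‖Φ r p‖ := by
    filter_upwards [hA, hB, hΦ'] with p h1 h2 h3
    rw [h1, h2, Finset.sum_congr rfl fun r hr => by rw [h3 r hr], ← Finset.mul_sum]
    have hsplit : w p = Complex.I * schwartzD 1 1 U p - Complex.I * (e p * U p) +
        (w p - (Complex.I * schwartzD 1 1 U p - Complex.I * (e p * U p))) := by ring
    have hreal : inner ℝ (U p) (Complex.I * (e p * U p)) = 0 := by
      simp only [Complex.inner]
      simp
      ring
    have hrest := (real_inner_le_norm (U p)
      (w p - (Complex.I * schwartzD 1 1 U p - Complex.I * (e p * U p)))).trans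
      (mul_le_mul_of_nonneg_left (hw p) (norm_nonneg _))
    rw [hsplit, inner_add_right, inner_sub_right, hreal]
    linarith
  have hR : ∀ r ∈ s, Integrable (fun p => ‖A p‖ * ‖Φ r p‖) := fun r _ =>
    (integral_norm_mul_norm_le A (Φ r)).1
  have hS : Integrable (fun p => K * ∑ r ∈ s, ‖A p‖ * ‖Φ r p‖) :=
    (integrable_finsetSum s hR).const_mul K
  calc inner ℝ A B = ∫ p, inner ℝ (A p) (B p) := L2.inner_def A B
    _ ≤ ∫ p, (inner ℝ (U p) (Complex.I * schwartzD 1 1 U p) +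
        K * ∑ r ∈ s, ‖A p‖ * ‖Φ r p‖) :=
      integral_mono_ae (L2.integrable_inner A B) (hI.add hS) hpt
    _ = K * ∑ r ∈ s, ∫ p, ‖A p‖ * ‖Φ r p‖ := by
      rw [integral_add hI hS, hI0, zero_add, integral_const_mul, integral_finsetSum s hR]
    _ ≤ K * ∑ r ∈ s, ‖A‖ * ‖Φ r‖ := by
      gcongr with r hr
      exact (integral_norm_mul_norm_le A (Φ r)).2
    _ = _ := by rw [← Finset.mul_sum, mul_assoc]

end Energy

/-- Propagation of regularity for the von Neumann equation in Weyl variables,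
uniformly in `ħ ∈ (0,1]` (Proposition 4.1). -/
theorem vonNeumann_regularity_propagation (m : ℕ) (hm : 1 ≤ m) (V : ℝ → ℝ)
    (hV : ContDiff ℝ (m+1) V)
    (hVb : ∀ n : ℕ, 2 ≤ n → n ≤ m+1 → ∃ C : ℝ, ∀ x : ℝ, |iteratedDeriv n V x| ≤ C) :
    ∃ C : ℝ, 0 < C ∧ ∀ hbar : ℝ, 0 < hbar → hbar ≤ 1 →
      ∀ R : ℝ → ℝ → ℝ → ℂ, IsVNSol hbar V R →
        ∀ t : ℝ, 0 ≤ t → NN m (R t) ≤ NN m (R 0) * Real.exp (C * t) := by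
  obtain ⟨M, hM, hVM⟩ := exists_iteratedDeriv_bound hV hVb
  set K : ℝ := 2 * m + m ^ 2 + (m + 1) ^ 2 * (2 ^ m * 2 ^ m * (3 * M)) with hKdef
  have hK : 0 ≤ K := by positivity
  refine ⟨K * (multiIndices m).card + 1, by positivity, fun hbar h0 h1 R hR t ht => ?_⟩
  obtain ⟨⟨-, hS, hC⟩, heq⟩ := hR
  choose Ψ Ψ' hΨ hΨ' hder _ using hC
  let Φ : ℕ × ℕ × ℕ × ℕ → ℝ → Lp ℂ 2 (volume : Measure (ℝ × ℝ)) :=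
    fun q => Ψ q.1 q.2.1 q.2.2.1 q.2.2.2
  let Φ' : ℕ × ℕ × ℕ × ℕ → ℝ → Lp ℂ 2 (volume : Measure (ℝ × ℝ)) :=
    fun q => Ψ' q.1 q.2.1 q.2.2.1 q.2.2.2
  have hNN : ∀ τ, 0 ≤ τ → NN m (R τ) = ∑ q ∈ multiIndices m, ‖Φ q τ‖ := fun τ hτ =>
    Finset.sum_congr rfl fun q _ => by
      rw [L2, Lp.norm_def, eLpNorm_congr_ae (hΨ _ _ _ _ τ hτ)]
  have henergy : ∀ q ∈ multiIndices m, ∀ τ : ℝ, 0 ≤ τ →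
      inner ℝ (Φ q τ) (Φ' q τ) ≤ K * ‖Φ q τ‖ * ∑ r ∈ multiIndices m, ‖Φ r τ‖ := by
    rintro ⟨a, b, α, β⟩ hq τ hτ
    have hle := mem_multiIndices.1 hq
    let F : SchwartzMap (ℝ × ℝ) ℂ := ⟨unc (R τ), (hS τ hτ).1, (hS τ hτ).2⟩
    let E : ℝ → ℝ → ℂ := fun x y =>
      (((V (x + hbar * y / 2) - V (x - hbar * y / 2)) / hbar : ℝ) : ℂ)
    have hRF : R τ = fun x y => F (x, y) := rfl
    have hg : dtR R τ = fun x y => Complex.I * pd2 1 1 (fun x y => F (x, y)) x y -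
        Complex.I * E x y * F (x, y) := by
      funext x y
      exact heq τ hτ x y
    have hW : ∀ n : ℕ, n ≤ m → ContDiff ℝ n (fun x => (V x : ℂ)) := fun n hn =>
      Complex.ofRealCLM.contDiff.comp (hV.of_le (by exact_mod_cast Nat.le_succ_of_le hn))
    have hE : ∀ x, ContDiff ℝ β (E x) := fun x => by
      simpa only [E, ofReal_diffQuot] using
        contDiff_diffQuot (hW β (by omega)) (hbar : ℂ) (hbar / 2) x
    have hEx : ∀ y, ∀ k ≤ β, ContDiff ℝ b (fun x => iteratedDeriv k (E x) y) := fun y k hk => by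
      have h2 : ContDiff ℝ b (iteratedDeriv k fun x => (V x : ℂ)) :=
        contDiff_iteratedDeriv (hW (b + k) (by omega))
      simp only [E, ofReal_diffQuot, iteratedDeriv_diffQuot (hW k (by omega))]
      fun_prop
    refine inner_le_of_norm_sub_le (multiIndices m) (schwartzWD a b α β F)
      (fun r => schwartzWD r.1 r.2.1 r.2.2.1 r.2.2.2 F)
      (fun p => (V (p.1 + hbar * p.2 / 2) - V (p.1 - hbar * p.2 / 2)) / hbar)
      (unc (wD a b α β (dtR R τ))) hK (fun p => ?_) _ _ _ ?_ (hΨ' a b α β τ hτ) fun r _ => ?_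
    · rw [hg]
      exact norm_wD_generator_sub_le hle F hM p.1 p.2 hE (hEx p.2)
        fun j k hjk hjk' => norm_pd2_diffQuot_le hV hM hVM h0 h1 hjk hjk' p.1 p.2
    · refine (hΨ a b α β τ hτ).trans (Filter.EventuallyEq.of_eq ?_)
      funext p
      exact wD_schwartz a b α β F p.1 p.2
    · refine (hΨ _ _ _ _ τ hτ).trans (Filter.EventuallyEq.of_eq ?_)
      funext p
      exact wD_schwartz _ _ _ _ F p.1 p.2
  have hfinal := sum_norm_le_of_inner_deriv_le (multiIndices m) Φ Φ' hK
    (fun q _ τ hτ => hder _ _ _ _ τ hτ) henergy ht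
  rw [hNN t ht, hNN 0 le_rfl]
  refine hfinal.trans ?_
  gcongr
  linarith

end
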